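/- Let X ⊆ ℝⁿ be a closed set with 0 ∈ X and let f : ℝⁿ → ℝ be a C² function. If 0 is a local minimizer of f on X, then for every u ∈ T₀X \ {0} with ⟨∇f(0), u⟩ = 0 and every w ∈ T²_{0,u}X, one has ⟨u, ∇²f(0) u⟩ + ⟨∇f(0), w⟩ ≥ 0. -/

import Mathlib

open Filter Topology RealInnerProductSpace

/-- The tangent cone `T_p X` of `X ⊆ ℝⁿ` at `p`. -/
def tangentConeAt' {n : ℕ} (X : Set (EuclideanSpace ℝ (Fin n)))
    (p : EuclideanSpace ℝ (Fin n)) : Set (EuclideanSpace ℝ (Fin n)) :=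
  {u | ∃ t : ℕ → ℝ, ∃ c : ℕ → EuclideanSpace ℝ (Fin n),
    (∀ k, 0 < t k) ∧ Tendsto t atTop (𝓝 0) ∧ Tendsto c atTop (𝓝 u) ∧
    ∀ k, p + t k • c k ∈ X}

/-- The directional second-order tangent set `T²_{p,u} X`. -/
def secondTangentSet {n : ℕ} (X : Set (EuclideanSpace ℝ (Fin n)))
    (p u : EuclideanSpace ℝ (Fin n)) : Set (EuclideanSpace ℝ (Fin n)) :=
  {w | ∃ t : ℕ → ℝ, ∃ W : ℕ → EuclideanSpace ℝ (Fin n),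
    (∀ k, 0 < t k) ∧ Tendsto t atTop (𝓝 0) ∧ Tendsto W atTop (𝓝 w) ∧
    ∀ k, p + t k • u + ((1 / 2 : ℝ) * t k ^ 2) • W k ∈ X}

open Asymptotics in
/-- Second-order Taylor expansion of a `C²` function at `0` along a line. -/
theorem ContDiff.isLittleO_taylor_two_smul {E F : Type*} [NormedAddCommGroup E] [NormedSpace ℝ E]
    [NormedAddCommGroup F] [NormedSpace ℝ F] {f : E → F} (hf : ContDiff ℝ 2 f) (u : E) :
    (fun s : ℝ => f (s • u) - f 0 - s • fderiv ℝ f 0 u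
      - (s ^ 2 / 2) • iteratedFDeriv ℝ 2 f 0 fun _ => u) =o[𝓝 0] fun s : ℝ => s ^ 2 := by
  have hline (s : ℝ) : HasDerivAt (fun s : ℝ => s • u) u s := by
    simpa using (hasDerivAt_id s).smul_const u
  have hdf : Differentiable ℝ (fderiv ℝ f) :=
    (hf.fderiv_right (m := 1) (by norm_num)).differentiable (by norm_num)
  have hderiv (s : ℝ) : HasDerivAt
      (fun s : ℝ => f (s • u) - s • fderiv ℝ f 0 u
        - (s ^ 2 / 2) • iteratedFDeriv ℝ 2 f 0 fun _ => u)
      (fderiv ℝ f (s • u) u - fderiv ℝ f 0 u - s • iteratedFDeriv ℝ 2 f 0 fun _ => u) s := by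
    have h₁ : HasDerivAt (fun s : ℝ => f (s • u)) (fderiv ℝ f (s • u) u) s :=
      ((hf.differentiable (by norm_num)) (s • u)).hasFDerivAt.comp_hasDerivAt s (hline s)
    have h₂ : HasDerivAt (fun s : ℝ => s • fderiv ℝ f 0 u) (fderiv ℝ f 0 u) s := by
      simpa using (hasDerivAt_id s).smul_const (fderiv ℝ f 0 u)
    have h₃ : HasDerivAt (fun s : ℝ => s ^ 2 / 2) s s := by
      simpa using ((hasDerivAt_id s).pow 2).div_const 2
    exact (h₁.sub h₂).sub (h₃.smul_const _)
  have hsmall : (fun s : ℝ => fderiv ℝ f (s • u) u - fderiv ℝ f 0 u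
      - s • iteratedFDeriv ℝ 2 f 0 fun _ => u) =o[𝓝 0] fun s : ℝ => (s - 0) ^ 1 := by
    have h₀ : HasFDerivAt (fun x => fderiv ℝ f x u)
        ((fderiv ℝ (fderiv ℝ f) 0).flip u) ((0 : ℝ) • u) := by
      rw [zero_smul]
      exact ((ContinuousLinearMap.apply ℝ F u).hasFDerivAt (x := fderiv ℝ f 0)).comp
        (0 : E) (hdf 0).hasFDerivAt
    have h₁ := (h₀.comp_hasDerivAt (0 : ℝ) (hline 0)).isLittleO
    simpa [iteratedFDeriv_two_apply] using h₁
  have h := convex_univ.isLittleO_pow_succ_real (Set.mem_univ (0 : ℝ))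
    (fun s _ => (hderiv s).hasDerivWithinAt) (by simpa only [nhdsWithin_univ] using hsmall)
  simpa [nhdsWithin_univ, sub_right_comm] using h

open Asymptotics in
/-- Second-order expansion of a `C²` function at `0` along a parabolic sequence
`t k • u + (1 / 2) * t k ^ 2 • W k`. -/
theorem ContDiff.tendsto_parabolic_taylor {E F : Type*} [NormedAddCommGroup E] [NormedSpace ℝ E]
    [NormedAddCommGroup F] [NormedSpace ℝ F] {f : E → F} (hf : ContDiff ℝ 2 f) {u w : E}
    {t : ℕ → ℝ} {W : ℕ → E} (ht : ∀ k, t k ≠ 0) (ht0 : Tendsto t atTop (𝓝 0))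
    (hW : Tendsto W atTop (𝓝 w)) :
    Tendsto (fun k => (t k ^ 2 / 2)⁻¹ •
        (f (t k • u + ((1 / 2 : ℝ) * t k ^ 2) • W k) - f 0 - t k • fderiv ℝ f 0 u))
      atTop (𝓝 ((iteratedFDeriv ℝ 2 f 0 fun _ => u) + fderiv ℝ f 0 w)) := by
  have hline := (hf.isLittleO_taylor_two_smul u).comp_tendsto ht0
  have htu : Tendsto (fun k => t k • u) atTop (𝓝 0) := by
    simpa using ht0.smul_const u
  have htW : Tendsto (fun k => ((1 / 2 : ℝ) * t k ^ 2) • W k) atTop (𝓝 0) := by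
    simpa using ((ht0.pow 2).const_mul (1 / 2 : ℝ)).smul hW
  have hpair : Tendsto (fun k => (t k • u + ((1 / 2 : ℝ) * t k ^ 2) • W k, t k • u)) atTop
      (𝓝 ((0 : E), (0 : E))) := by
    simpa using (htu.add htW).prodMk_nhds htu
  have hstrict := (hf.contDiffAt.hasStrictFDerivAt (x := (0 : E))
    (by norm_num)).isLittleO.comp_tendsto hpair
  have hbound : (fun k => ((1 / 2 : ℝ) * t k ^ 2) • W k) =O[atTop] fun k => t k ^ 2 := by
    simpa using (isBigO_const_mul_self (1 / 2 : ℝ) (fun k => t k ^ 2) atTop).smul (hW.isBigO_one ℝ)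
  have hcurve := hstrict.trans_isBigO (by simpa [Function.comp_def] using hbound)
  have hrem := (hline.add hcurve).tendsto_inv_smul_nhds_zero
  have hlim : Tendsto (fun k => (iteratedFDeriv ℝ 2 f 0 fun _ => u) + fderiv ℝ f 0 (W k)) atTop
      (𝓝 ((iteratedFDeriv ℝ 2 f 0 fun _ => u) + fderiv ℝ f 0 w)) :=
    (((fderiv ℝ f 0).continuous.tendsto w).comp hW).const_add _
  have h := (hrem.const_smul (2 : ℝ)).add hlim
  rw [smul_zero, zero_add] at h
  refine h.congr fun k => ?_
  have htk := ht k
  simp only [Function.comp_apply, add_sub_cancel_left, map_smul]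
  match_scalars <;> field_simp <;> ring

/-- Second-order necessary optimality condition: if `0` is a local
minimizer of a `C²` function `f` on a closed set `X ∋ 0`, then for every nonzero
critical tangent direction `u` and every `w ∈ T²_{0,u} X`,
`⟨u, ∇²f(0)u⟩ + ⟨∇f(0), w⟩ ≥ 0`. -/
theorem stmt8 {n : ℕ} (X : Set (EuclideanSpace ℝ (Fin n))) (hXcl : IsClosed X)
    (hX0 : (0 : EuclideanSpace ℝ (Fin n)) ∈ X)
    (f : EuclideanSpace ℝ (Fin n) → ℝ) (hf : ContDiff ℝ 2 f)
    (hmin : IsLocalMinOn f X 0) :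
    ∀ u ∈ tangentConeAt' X 0, u ≠ 0 → ⟪gradient f 0, u⟫ = 0 →
      ∀ w ∈ secondTangentSet X 0 u,
        0 ≤ (iteratedFDeriv ℝ 2 f 0 fun _ => u) + ⟪gradient f 0, w⟫ := by
  rintro u - - hu w ⟨t, W, htpos, ht0, hW, hX⟩
  rw [inner_gradient_left] at hu ⊢
  simp only [zero_add] at hX
  have hx : Tendsto (fun k => t k • u + ((1 / 2 : ℝ) * t k ^ 2) • W k) atTop (𝓝[X] 0) := by
    refine tendsto_nhdsWithin_iff.2 ⟨?_, .of_forall hX⟩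
    simpa using (ht0.smul_const u).add (((ht0.pow 2).const_mul (1 / 2 : ℝ)).smul hW)
  refine ge_of_tendsto (hf.tendsto_parabolic_taylor (fun k => (htpos k).ne') ht0 hW) ?_
  filter_upwards [hx.eventually hmin] with k hk
  rw [hu, smul_zero, sub_zero]
  exact smul_nonneg (by positivity) (sub_nonneg.2 hk)
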